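/- Let G be a group, F a field, and let α, β be nonzero elements of F[G] with αβ = 0. Then for every x in the product set supp(α)·supp(β), the number of pairs (h, g) ∈ supp(α) × supp(β) with hg = x is at least 2. -/

import Mathlib

open scoped Pointwise

/-- If `α, β` are nonzero elements of `F[G]` with `α * β = 0`, then for every
`x ∈ supp(α) · supp(β)` the number of pairs `(h, g) ∈ supp(α) × supp(β)` with `h * g = x`
is at least `2`. -/
theorem two_le_rBC {G : Type*} [Group G] [DecidableEq G] {F : Type*} [Field F]
    (α β : MonoidAlgebra F G) (hα : α ≠ 0) (hβ : β ≠ 0) (hmul : α * β = 0) :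
    ∀ x ∈ α.coeff.support * β.coeff.support,
      2 ≤ ((α.coeff.support ×ˢ β.coeff.support).filter (fun p => p.1 * p.2 = x)).card := by
  intro x hx
  obtain ⟨a, ha, b, hb, rfl⟩ := Finset.mem_mul.mp hx
  by_contra! hcard
  have hunique : UniqueMul α.coeff.support β.coeff.support a b := by
    intro c d hc hd hcd
    have h := Finset.card_le_one.mp (Nat.le_of_lt_succ hcard) (c, d) (by simp_all)
      (a, b) (by simp_all)
    simpa using h
  have h := MonoidAlgebra.coeff_mul_mul_of_uniqueMul hunique
  simp_all
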